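/- arXiv:2604.02186 — 3 statements merged into one kernel-verified Lean document; each statement's English description precedes it below -/
import Mathlib

section
/- Let n ≥ 1 be a natural number and let R = MvPolynomial (Fin (n+1)) ℂ be the polynomial ring ℂ[x₀,…,xₙ] with its standard grading by total degree. Suppose p and q are prime ideals of R that are homogeneous with respect to this grading, and suppose that ringKrullDim (R ⧸ p) + ringKrullDim (R ⧸ q) ≥ n + 2. Then there exists a point z : Fin (n+1) → ℂ with z ≠ 0 such that every polynomial in p vanishes at z and every polynomial in q vanishes at z. -/
open MvPolynomial

attribute [local instance] MvPolynomial.gradedAlgebra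

open scoped TensorProduct

/-- Every maximal ideal of a polynomial ring in `s` variables over a field has height `s`. -/
theorem MvPolynomial.height_eq_of_isMaximal {k : Type*} [Field k] :
    ∀ (s : ℕ) (M : Ideal (MvPolynomial (Fin s) k)) [M.IsMaximal], M.height = s
  | 0, M, _ => by
    have h : ringKrullDim (MvPolynomial (Fin 0) k) = 0 := by simp
    have h' := Ideal.height_le_ringKrullDim_of_ne_top (Ideal.IsMaximal.ne_top ‹M.IsMaximal›)
    rw [h] at h'
    simpa using h'
  | s + 1, M, _ => by
    let e := (finSuccEquiv k s).toRingEquiv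
    let N : Ideal (Polynomial (MvPolynomial (Fin s) k)) := M.map e
    have : N.IsMaximal := Ideal.map_isMaximal_of_equiv e
    have : (N.comap Polynomial.C).IsMaximal :=
      Polynomial.isMaximal_comap_C_of_isJacobsonRing N
    have : N.LiesOver (N.comap Polynomial.C) := ⟨rfl⟩
    rw [← e.height_map M, Polynomial.height_eq_height_add_one (N.comap Polynomial.C) N,
      height_eq_of_isMaximal s]
    simp

/-- Krull dimension does not increase along integral extensions. -/
theorem ringKrullDim_le_of_isIntegral (R S : Type*) [CommRing R] [CommRing S] [Algebra R S]
    [Algebra.IsIntegral R S] : ringKrullDim S ≤ ringKrullDim R :=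
  Order.krullDim_le_of_strictMono (PrimeSpectrum.comap (algebraMap R S)) fun _ _ h ↦
    Ideal.IsIntegral.comap_lt_comap h

/-- In a domain of finite type over a field, every maximal ideal has height equal to the dimension;
this is the nontrivial inequality. -/
theorem ringKrullDim_le_height_of_isMaximal (k : Type*) {A : Type*} [Field k] [CommRing A]
    [IsDomain A] [Algebra k A] [Algebra.FiniteType k A] (m : Ideal A) [m.IsMaximal] :
    ringKrullDim A ≤ m.height := by
  obtain ⟨s, g, hg, hgi⟩ := exists_integral_inj_algHom_of_fg k A
  algebraize [g.toRingHom]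
  have : Algebra.IsIntegral (MvPolynomial (Fin s) k) A := ⟨hgi⟩
  have : FaithfulSMul (MvPolynomial (Fin s) k) A :=
    (faithfulSMul_iff_algebraMap_injective _ _).2 hg
  have : IsNoetherianRing A := Algebra.FiniteType.isNoetherianRing k A
  let n := m.under (MvPolynomial (Fin s) k)
  have : n.IsMaximal := Ideal.isMaximal_comap_of_isIntegral_of_isMaximal m
  have h := Ideal.height_eq_height_add_of_liesOver_of_hasGoingDown n m
  have h' : (s : ℕ∞) ≤ m.height := by
    rw [h, height_eq_of_isMaximal s n]
    exact le_self_add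
  refine (ringKrullDim_le_of_isIntegral (MvPolynomial (Fin s) k) A).trans ?_
  simpa using WithBot.coe_le_coe.2 h'

theorem Ideal.height_le_height_comap_of_surjective {R S : Type*} [CommRing R] [CommRing S]
    {f : R →+* S} (hf : Function.Surjective f) (I : Ideal S) [I.IsPrime] :
    I.height ≤ (I.comap f).height := by
  rw [PrimeSpectrum.height_eq_orderHeight ⟨I, ‹_›⟩,
    PrimeSpectrum.height_eq_orderHeight ⟨I.comap f, inferInstance⟩]
  exact Order.height_le_height_apply_of_strictMono (PrimeSpectrum.comap f)
    (RingHom.strictMono_comap_of_surjective hf) _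

/-- The heights of two rational points add up to at most the height of the point of the product
they determine. -/
theorem Algebra.TensorProduct.height_ker_add_height_ker_le {k A B : Type*} [Field k]
    [CommRing A] [CommRing B] [Algebra k A] [Algebra k B] [IsNoetherianRing A]
    [IsNoetherianRing (A ⊗[k] B)]
    (f : A →ₐ[k] k) (g : B →ₐ[k] k) :
    (RingHom.ker f).height + (RingHom.ker g).height ≤
      (RingHom.ker (lift f g fun _ _ ↦ Commute.all _ _)).height := by
  set F := lift f g fun _ _ ↦ Commute.all _ _
  have : (RingHom.ker f).IsPrime := RingHom.ker_isPrime f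
  have : (RingHom.ker g).IsPrime := RingHom.ker_isPrime g
  have : (RingHom.ker F).IsPrime := RingHom.ker_isPrime F
  have : (RingHom.ker F).LiesOver (RingHom.ker f) := ⟨by
    ext a
    simp [F, Ideal.under, RingHom.mem_ker]⟩
  rw [Ideal.height_eq_height_add_of_liesOver_of_hasGoingDown (RingHom.ker f) (RingHom.ker F)]
  gcongr
  let G : A ⊗[k] B →ₐ[k] B := lift ((Algebra.ofId k B).comp f) (AlgHom.id k B)
    fun _ _ ↦ Commute.all _ _
  have hG : ∀ x ∈ (RingHom.ker f).map (algebraMap A (A ⊗[k] B)), G x = 0 := by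
    suffices (RingHom.ker f).map (algebraMap A (A ⊗[k] B)) ≤ RingHom.ker G from this
    rw [Ideal.map_le_iff_le_comap]
    intro a ha
    simp_all [G, RingHom.mem_ker]
  have hF : g.comp G = F := by
    ext <;> simp [F, G]
  let H := Ideal.Quotient.lift _ (G : A ⊗[k] B →+* B) hG
  have hHG (y : A ⊗[k] B) : H (Ideal.Quotient.mk _ y) = G y := rfl
  have hH : Function.Surjective H := fun b ↦
    ⟨Ideal.Quotient.mk _ (1 ⊗ₜ b), by simp [hHG, G]⟩
  refine (Ideal.height_le_height_comap_of_surjective hH _).trans (Ideal.height_mono ?_)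
  intro x hx
  obtain ⟨y, rfl⟩ := Ideal.Quotient.mk_surjective x
  refine Ideal.mem_map_of_mem _ ?_
  rw [RingHom.mem_ker, ← hF]
  simpa [hHG, RingHom.mem_ker] using hx

/-- A homogeneous proper ideal of a polynomial ring over a field vanishes at the origin. -/
theorem MvPolynomial.eval_zero_eq_zero_of_mem_of_isHomogeneous {σ k : Type*} [Field k]
    {p : Ideal (MvPolynomial σ k)} (hp : p ≠ ⊤)
    (hph : p.IsHomogeneous (homogeneousSubmodule σ k)) {f : MvPolynomial σ k} (hf : f ∈ p) :
    eval 0 f = 0 := by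
  have h := hph 0 hf
  rw [show (DirectSum.decompose (homogeneousSubmodule σ k) f 0 : MvPolynomial σ k) =
    homogeneousComponent 0 f from decomposition.decompose'_apply f 0, homogeneousComponent_zero] at h
  by_contra hne
  refine hp (Ideal.eq_top_of_isUnit_mem _ h ?_)
  simpa [← constantCoeff_eq, ← eval_zero] using hne

/-- Affine dimension theorem at the origin: if two closed subvarieties of affine space, with
coordinate rings `A` and `B`, pass through the origin and their dimensions add up to more than the
dimension of the space, then they meet in another point. -/
theorem MvPolynomial.exists_ne_zero_of_lt_ringKrullDim_add {k σ A B : Type*} [Field k]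
    [IsAlgClosed k] [Finite σ] [CommRing A] [IsDomain A] [Algebra k A] [CommRing B] [IsDomain B]
    [Algebra k B] {α : MvPolynomial σ k →ₐ[k] A} {β : MvPolynomial σ k →ₐ[k] B}
    (hα : Function.Surjective α) (hβ : Function.Surjective β) {a : A →ₐ[k] k} {b : B →ₐ[k] k}
    (ha : a.comp α = aeval 0) (hb : b.comp β = aeval 0)
    (hdim : (Nat.card σ : WithBot ℕ∞) < ringKrullDim A + ringKrullDim B) :
    ∃ z : σ → k, z ≠ 0 ∧ (∀ f, α f = 0 → eval z f = 0) ∧ (∀ f, β f = 0 → eval z f = 0) := by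
  by_contra! hz
  have : Algebra.FiniteType k A := .of_surjective α hα
  have : Algebra.FiniteType k B := .of_surjective β hβ
  have : IsNoetherianRing A := Algebra.FiniteType.isNoetherianRing k A
  have : Algebra.FiniteType k (A ⊗[k] B) := .trans (S := A) ‹_› inferInstance
  have : IsNoetherianRing (A ⊗[k] B) := Algebra.FiniteType.isNoetherianRing k _
  let F : A ⊗[k] B →ₐ[k] k := Algebra.TensorProduct.lift a b fun _ _ ↦ Commute.all _ _
  have : (RingHom.ker a).IsMaximal :=
    RingHom.ker_isMaximal_of_surjective a fun c ↦ ⟨algebraMap k A c, by simp⟩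
  have : (RingHom.ker b).IsMaximal :=
    RingHom.ker_isMaximal_of_surjective b fun c ↦ ⟨algebraMap k B c, by simp⟩
  have : (RingHom.ker F).IsPrime := RingHom.ker_isPrime F
  have hheight : (Nat.card σ : ℕ∞) < (RingHom.ker F).height := by
    refine lt_of_lt_of_le ?_ (Algebra.TensorProduct.height_ker_add_height_ker_le a b)
    rw [← WithBot.coe_lt_coe]
    exact hdim.trans_le (add_le_add (ringKrullDim_le_height_of_isMaximal k _)
      (ringKrullDim_le_height_of_isMaximal k _))
  let φ : MvPolynomial σ k →ₐ[k] A ⊗[k] B := Algebra.TensorProduct.includeLeft.comp α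
  let ψ : MvPolynomial σ k →ₐ[k] A ⊗[k] B := Algebra.TensorProduct.includeRight.comp β
  have haX (i : σ) : a (α (X i)) = 0 := by simpa using DFunLike.congr_fun ha (X i)
  have hbX (i : σ) : b (β (X i)) = 0 := by simpa using DFunLike.congr_fun hb (X i)
  let d : Set (A ⊗[k] B) := Set.range fun i ↦ φ (X i) - ψ (X i)
  have hd : Ideal.span d ≤ RingHom.ker F := by
    rw [Ideal.span_le]
    rintro _ ⟨i, rfl⟩
    simp [φ, ψ, F, RingHom.mem_ker, haX, hbX]
  obtain ⟨Q, hQ, -⟩ := Ideal.exists_minimalPrimes_le hd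
  have : Q.IsPrime := hQ.1.1
  have hQheight : Q.height ≤ (Nat.card σ : ℕ∞) := by
    refine (Ideal.height_le_card_of_mem_minimalPrimes_span (Set.finite_range _) hQ).trans ?_
    exact_mod_cast Finite.card_range_le _
  let π := Ideal.Quotient.mkₐ k Q
  have hφψ : π.comp φ = π.comp ψ := by
    ext i
    exact Ideal.Quotient.eq.2 (hQ.1.2 (Ideal.subset_span ⟨i, rfl⟩))
  have hφ : RingHom.ker α ≤ RingHom.ker (π.comp φ) := fun f hf ↦ by
    simp [φ, RingHom.mem_ker, (RingHom.mem_ker).1 hf]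
  have hψ : RingHom.ker β ≤ RingHom.ker (π.comp φ) := fun f hf ↦ by
    rw [hφψ]
    simp [ψ, RingHom.mem_ker, (RingHom.mem_ker).1 hf]
  have hπφ (i : σ) : π (φ (X i)) = 0 := by
    have hi : X i ∈ (RingHom.ker α ⊔ RingHom.ker β).radical := by
      rw [← vanishingIdeal_zeroLocus_eq_radical (K := k)]
      intro z hzαβ
      have hz0 : z = 0 := by
        by_contra hne
        obtain ⟨f, hf, hfz⟩ := hz z hne fun f hf ↦ hzαβ f (Ideal.mem_sup_left hf)
        exact hfz (hzαβ f (Ideal.mem_sup_right hf))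
      simp [hz0]
    exact (RingHom.ker_isPrime (π.comp φ)).radical_le_iff.2 (sup_le hφ hψ) hi
  have hπψ (i : σ) : π (ψ (X i)) = 0 := by
    rw [← hπφ i]
    exact (DFunLike.congr_fun hφψ (X i)).symm
  have hπ : π = (Algebra.ofId k _).comp F := by
    apply Algebra.TensorProduct.ext
    · refine (AlgHom.cancel_right hα).1 (MvPolynomial.algHom_ext fun i ↦ ?_)
      simpa [F, haX, φ] using hπφ i
    · refine (AlgHom.cancel_right hβ).1 (MvPolynomial.algHom_ext fun i ↦ ?_)
      simpa [F, hbX, ψ] using hπψ i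
  have hFQ : RingHom.ker F ≤ Q := fun t ht ↦ by
    rw [← Ideal.Quotient.eq_zero_iff_mem]
    change π t = 0
    rw [hπ, AlgHom.comp_apply, (RingHom.mem_ker).1 ht, map_zero]
  exact absurd (hheight.trans_le ((Ideal.height_mono hFQ).trans hQheight)) (lt_irrefl _)

/-- Affine-cone form of projective Bézout (1): two homogeneous primes in
`ℂ[x₀,…,xₙ]` whose quotients have Krull dimensions summing to at least `n + 2`
have a common nonzero zero in `ℂ^{n+1}`. -/
theorem bezout_projective_nonempty_intersection
    (n : ℕ) (hn : 1 ≤ n)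
    (p q : Ideal (MvPolynomial (Fin (n + 1)) ℂ))
    (hp : p.IsPrime) (hq : q.IsPrime)
    (hph : p.IsHomogeneous (homogeneousSubmodule (Fin (n + 1)) ℂ))
    (hqh : q.IsHomogeneous (homogeneousSubmodule (Fin (n + 1)) ℂ))
    (hdim : (n + 2 : WithBot (WithTop ℕ)) ≤
      ringKrullDim (MvPolynomial (Fin (n + 1)) ℂ ⧸ p) +
        ringKrullDim (MvPolynomial (Fin (n + 1)) ℂ ⧸ q)) :
    ∃ z : Fin (n + 1) → ℂ, z ≠ 0 ∧
      (∀ f ∈ p, MvPolynomial.eval z f = 0) ∧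
      (∀ f ∈ q, MvPolynomial.eval z f = 0) := by
  have hp0 (f) (hf : f ∈ p) : aeval (0 : Fin (n + 1) → ℂ) f = 0 :=
    eval_zero_eq_zero_of_mem_of_isHomogeneous hp.ne_top hph hf
  have hq0 (f) (hf : f ∈ q) : aeval (0 : Fin (n + 1) → ℂ) f = 0 :=
    eval_zero_eq_zero_of_mem_of_isHomogeneous hq.ne_top hqh hf
  have hlt : ((n + 1 : ℕ) : WithBot ℕ∞) < ((n + 2 : ℕ) : WithBot ℕ∞) :=
    Nat.cast_lt.2 (Nat.lt_succ_self (n + 1))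
  obtain ⟨z, hz, hzp, hzq⟩ := exists_ne_zero_of_lt_ringKrullDim_add
    (Ideal.Quotient.mkₐ_surjective ℂ p) (Ideal.Quotient.mkₐ_surjective ℂ q)
    (Ideal.Quotient.liftₐ_comp p (aeval 0) hp0) (Ideal.Quotient.liftₐ_comp q (aeval 0) hq0)
    (lt_of_lt_of_le (by
      simpa only [Nat.card_fin, Nat.cast_add, Nat.cast_ofNat] using! hlt) hdim)
  exact ⟨z, hz, fun f hf ↦ hzp f (Ideal.Quotient.eq_zero_iff_mem.2 hf),
    fun f hf ↦ hzq f (Ideal.Quotient.eq_zero_iff_mem.2 hf)⟩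
end

section
/- Let m ≥ 1 and let (nᵢ)_{i∈ℕ} be an injective sequence of integers. Then for Lebesgue-almost every y : Fin m → ℝ, the sequence of points nᵢ • y is equidistributed modulo ℤ^m: for every continuous function f : (Fin m → ℝ) → ℝ satisfying f(v + a) = f(v) for all v : Fin m → ℝ and all a : Fin m → ℤ, the averages (1/N) · Σ_{i=0}^{N−1} f(nᵢ • y) converge, as N → ∞, to the integral of f over the unit cube [0,1]^m. -/
open Filter MeasureTheory

theorem tendsto_average_of_tendsto_average_sq {E : Type*} [SeminormedAddCommGroup E]
    {e : ℕ → E} (he : ∀ i, ‖e i‖ ≤ 1)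
    (h : Tendsto (fun k : ℕ => ((k : ℝ) ^ 2)⁻¹ * ‖∑ i ∈ Finset.range (k ^ 2), e i‖) atTop (nhds 0)) :
    Tendsto (fun N : ℕ => (N : ℝ)⁻¹ * ‖∑ i ∈ Finset.range N, e i‖) atTop (nhds 0) := by
  have hsqrt : Tendsto Nat.sqrt atTop atTop :=
    tendsto_atTop.2 fun b => (eventually_ge_atTop (b * b)).mono fun _ h => Nat.le_sqrt.2 h
  have hinv : Tendsto (fun k : ℕ => 2 * (k : ℝ)⁻¹) atTop (nhds 0) := by
    simpa using (tendsto_inv_atTop_nhds_zero_nat (𝕜 := ℝ)).const_mul 2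
  have hlim := (h.add hinv).comp hsqrt
  rw [add_zero] at hlim
  refine squeeze_zero' (Eventually.of_forall fun N => by positivity) ?_ hlim
  filter_upwards [eventually_ge_atTop 1] with N hN
  set k := Nat.sqrt N with hk
  have hk1 : 1 ≤ k := Nat.le_sqrt.2 (by simpa using hN)
  have hkN : k ^ 2 ≤ N := Nat.sqrt_le' N
  have hNk : N ≤ k ^ 2 + 2 * k := by
    have := Nat.sqrt_le_add N
    rw [← hk] at this
    nlinarith
  have hsum : ‖∑ i ∈ Finset.range N, e i‖ ≤ ‖∑ i ∈ Finset.range (k ^ 2), e i‖ + 2 * k := by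
    rw [← Finset.sum_range_add_sum_Ico _ hkN]
    refine (norm_add_le _ _).trans (add_le_add_right ?_ _)
    calc ‖∑ i ∈ Finset.Ico (k ^ 2) N, e i‖ ≤ ∑ i ∈ Finset.Ico (k ^ 2) N, (1 : ℝ) :=
          norm_sum_le_of_le _ fun i _ => he i
      _ = ((N - k ^ 2 : ℕ) : ℝ) := by simp
      _ ≤ 2 * k := by exact_mod_cast (by omega : N - k ^ 2 ≤ 2 * k)
  have hk0 : (0 : ℝ) < k := by exact_mod_cast hk1
  have hkN' : (k : ℝ) ^ 2 ≤ N := by exact_mod_cast hkN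
  calc (N : ℝ)⁻¹ * ‖∑ i ∈ Finset.range N, e i‖
      ≤ ((k : ℝ) ^ 2)⁻¹ * (‖∑ i ∈ Finset.range (k ^ 2), e i‖ + 2 * k) := by gcongr
    _ = _ := by
      simp only [Function.comp, ← hk]
      field_simp

theorem integral_norm_sq_sum_le_of_orthogonal {Ω : Type*} [MeasurableSpace Ω] {μ : Measure Ω}
    [IsProbabilityMeasure μ] {e : ℕ → Ω → ℂ} (hm : ∀ i, Measurable (e i))
    (he : ∀ i x, ‖e i x‖ ≤ 1)
    (horth : Pairwise fun i j => ∫ x, e i x * starRingEnd ℂ (e j x) ∂μ = 0) (N : ℕ) :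
    ∫ x, ‖∑ i ∈ Finset.range N, e i x‖ ^ 2 ∂μ ≤ N := by
  have hint : ∀ i j, Integrable (fun x => e i x * starRingEnd ℂ (e j x)) μ := fun i j =>
    .of_bound (C := 1) (by fun_prop) (Eventually.of_forall fun x => by
      simpa using mul_le_one₀ (he i x) (norm_nonneg _) (he j x))
  have hdiag : ∀ i, ‖∫ x, e i x * starRingEnd ℂ (e i x) ∂μ‖ ≤ 1 := fun i => by
    simpa using norm_integral_le_of_norm_le_const (μ := μ) (C := 1)
      (Eventually.of_forall fun x => by
        simpa using mul_le_one₀ (he i x) (norm_nonneg _) (he i x))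
  have key : ((∫ x, ‖∑ i ∈ Finset.range N, e i x‖ ^ 2 ∂μ : ℝ) : ℂ) =
      ∑ i ∈ Finset.range N, ∫ x, e i x * starRingEnd ℂ (e i x) ∂μ := by
    rw [← integral_complex_ofReal]
    have : ∀ x, ((‖∑ i ∈ Finset.range N, e i x‖ ^ 2 : ℝ) : ℂ) =
        ∑ i ∈ Finset.range N, ∑ j ∈ Finset.range N, e i x * starRingEnd ℂ (e j x) := fun x => by
      rw [← Finset.sum_mul_sum, ← map_sum, Complex.mul_conj, Complex.normSq_eq_norm_sq]
    simp_rw [this]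
    rw [integral_finsetSum _ fun i _ => integrable_finsetSum _ fun j _ => hint i j]
    refine Finset.sum_congr rfl fun i hi => ?_
    rw [integral_finsetSum _ fun j _ => hint i j]
    exact Finset.sum_eq_single_of_mem i hi fun j _ hj => horth hj.symm
  calc ∫ x, ‖∑ i ∈ Finset.range N, e i x‖ ^ 2 ∂μ
      ≤ ‖((∫ x, ‖∑ i ∈ Finset.range N, e i x‖ ^ 2 ∂μ : ℝ) : ℂ)‖ := by
        rw [Complex.norm_real]; exact le_abs_self _
    _ ≤ ∑ i ∈ Finset.range N, (1 : ℝ) := by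
        rw [key]; exact norm_sum_le_of_le _ fun i _ => hdiag i
    _ = N := by simp

theorem ae_tendsto_average_zero_of_orthogonal {Ω : Type*} [MeasurableSpace Ω] {μ : Measure Ω}
    [IsProbabilityMeasure μ] {e : ℕ → Ω → ℂ} (hm : ∀ i, Measurable (e i))
    (he : ∀ i x, ‖e i x‖ ≤ 1)
    (horth : Pairwise fun i j => ∫ x, e i x * starRingEnd ℂ (e j x) ∂μ = 0) :
    ∀ᵐ x ∂μ, Tendsto (fun N : ℕ => (N : ℂ)⁻¹ * ∑ i ∈ Finset.range N, e i x)
      atTop (nhds 0) := by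
  let F : ℕ → Ω → ℝ := fun k x => (((k : ℝ) ^ 2)⁻¹ * ‖∑ i ∈ Finset.range (k ^ 2), e i x‖) ^ 2
  have hFm : ∀ k, Measurable (F k) := fun k => by fun_prop
  have hF0 : ∀ k x, 0 ≤ F k x := fun k x => by positivity
  have hFint : ∀ k, Integrable (F k) μ := fun k => by
    refine .of_bound (C := (((k : ℝ) ^ 2)⁻¹ * (k ^ 2 : ℕ)) ^ 2) (hFm k).aestronglyMeasurable
      (Eventually.of_forall fun x => ?_)
    rw [Real.norm_of_nonneg (hF0 k x)]
    have : ‖∑ i ∈ Finset.range (k ^ 2), e i x‖ ≤ (k ^ 2 : ℕ) := by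
      exact (norm_sum_le_of_le _ fun i _ => he i x).trans_eq (by simp)
    simp only [F]
    gcongr
  have hFle : ∀ k, ∫ x, F k x ∂μ ≤ ((k : ℝ) ^ 2)⁻¹ := fun k => by
    simp only [F, mul_pow]
    rw [integral_const_mul]
    have := integral_norm_sq_sum_le_of_orthogonal hm he horth (k ^ 2)
    rcases eq_or_ne k 0 with rfl | hk
    · simp
    calc (((k : ℝ) ^ 2)⁻¹) ^ 2 * ∫ x, ‖∑ i ∈ Finset.range (k ^ 2), e i x‖ ^ 2 ∂μ
        ≤ (((k : ℝ) ^ 2)⁻¹) ^ 2 * (k ^ 2 : ℕ) := by gcongr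
      _ = _ := by push_cast; field_simp
  have hfin : ∫⁻ x, ∑' k, ENNReal.ofReal (F k x) ∂μ ≠ ⊤ := by
    rw [lintegral_tsum fun k => (hFm k).ennreal_ofReal.aemeasurable]
    refine ne_top_of_le_ne_top
      (Real.summable_nat_pow_inv.2 one_lt_two).tsum_ofReal_ne_top (ENNReal.tsum_le_tsum fun k => ?_)
    rw [← ofReal_integral_eq_lintegral_ofReal (hFint k) (Eventually.of_forall (hF0 k))]
    exact ENNReal.ofReal_le_ofReal (hFle k)
  filter_upwards [ae_lt_top' (AEMeasurable.tsum
    fun k => (hFm k).ennreal_ofReal.aemeasurable) hfin] with x hx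
  have h0 : Tendsto (fun k => F k x) atTop (nhds 0) := by
    have := (ENNReal.tendsto_toReal ENNReal.zero_ne_top).comp
      (ENNReal.tendsto_atTop_zero_of_tsum_ne_top hx.ne)
    simpa [Function.comp_def, ENNReal.toReal_ofReal, hF0] using this
  rw [tendsto_zero_iff_norm_tendsto_zero]
  simp only [norm_mul, norm_inv, Complex.norm_natCast]
  refine tendsto_average_of_tendsto_average_sq (fun i => he i x) ?_
  have := h0.sqrt
  rw [Real.sqrt_zero] at this
  refine this.congr fun k => Real.sqrt_sq (by positivity)

namespace UnitAddTorus

variable {d : Type*} [Fintype d]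

theorem norm_mFourier_apply_le (k : d → ℤ) (x : UnitAddTorus d) : ‖mFourier k x‖ ≤ 1 :=
  ((mFourier k).norm_coe_le_norm x).trans_eq mFourier_norm

theorem mFourier_coe_zsmul (k : d → ℤ) (n : ℤ) (y : d → ℝ) :
    mFourier k (fun i => ((n • y) i : UnitAddCircle)) =
      mFourier (n • k) (fun i => (y i : UnitAddCircle)) := by
  simp only [mFourier, ContinuousMap.coe_mk, fourier_apply, Pi.smul_apply, AddCircle.coe_zsmul,
    smul_smul, smul_eq_mul, mul_comm]

omit [Fintype d] in
theorem continuous_mk : Continuous fun (y : d → ℝ) (i : d) => (y i : UnitAddCircle) := by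
  fun_prop

omit [Fintype d] in
theorem setOf_forall_mem_Ioc_eq_pi (a : d → ℝ) :
    {x : d → ℝ | ∀ i, x i ∈ Set.Ioc (a i) (a i + 1)} =
      Set.univ.pi fun i => Set.Ioc (a i) (a i + 1) := by
  ext; simp

instance isProbabilityMeasure_restrict_unitCube (a : d → ℝ) :
    IsProbabilityMeasure
      (volume.restrict {x : d → ℝ | ∀ i, x i ∈ Set.Ioc (a i) (a i + 1)}) := by
  constructor
  rw [Measure.restrict_apply_univ, setOf_forall_mem_Ioc_eq_pi]
  simp [volume_pi_pi]

theorem setIntegral_unitCube_mFourier {k : d → ℤ} (hk : k ≠ 0) (a : d → ℝ) :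
    ∫ x in {x : d → ℝ | ∀ i, x i ∈ Set.Ioc (a i) (a i + 1)},
      mFourier k (fun i => (x i : UnitAddCircle)) = 0 := by
  rw [← integral_preimage (fun x => mFourier k x) a]
  have := (orthonormal_mFourier (d := d)).2 hk.symm
  simpa [ContinuousMap.inner_toLp, mFourier_zero] using this

theorem ae_tendsto_average_mFourier_zsmul {n : ℕ → ℤ} (hn : Function.Injective n)
    {k : d → ℤ} (hk : k ≠ 0) :
    ∀ᵐ y : d → ℝ, Tendsto (fun N : ℕ => (N : ℂ)⁻¹ * ∑ j ∈ Finset.range N,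
      mFourier k (fun i => ((n j • y) i : UnitAddCircle))) atTop (nhds 0) := by
  have hcover : ⋃ b : d → ℤ, {x : d → ℝ | ∀ i, x i ∈ Set.Ioc (b i : ℝ) (b i + 1)} = Set.univ := by
    refine Set.eq_univ_of_forall fun x => Set.mem_iUnion.2 ⟨fun i => ⌈x i⌉ - 1, fun i => ?_⟩
    push_cast
    exact ⟨by linarith [Int.ceil_lt_add_one (x i)], by linarith [Int.le_ceil (x i)]⟩
  rw [← Measure.restrict_univ (μ := volume), ← hcover, ae_restrict_iUnion_iff]
  intro b
  refine ae_tendsto_average_zero_of_orthogonal (fun j => ?_)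
    (fun j x => norm_mFourier_apply_le _ _) fun i j hij => ?_
  · exact Continuous.measurable (by fun_prop)
  · simp_rw [mFourier_coe_zsmul, ← mFourier_neg, ← mFourier_add]
    refine setIntegral_unitCube_mFourier (fun h => hij (hn ?_)) _
    exact smul_left_injective ℤ hk (by simpa [← sub_eq_add_neg, sub_eq_zero] using h)

/-- **Weyl's criterion** on the torus. -/
theorem tendsto_average_of_tendsto_average_mFourier {ν : Measure (UnitAddTorus d)}
    [IsProbabilityMeasure ν] (hν : ∀ k : d → ℤ, k ≠ 0 → ∫ x, mFourier k x ∂ν = 0)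
    {u : ℕ → UnitAddTorus d}
    (hu : ∀ k : d → ℤ, k ≠ 0 → Tendsto
      (fun N : ℕ => (N : ℂ)⁻¹ * ∑ j ∈ Finset.range N, mFourier k (u j)) atTop (nhds 0))
    (g : C(UnitAddTorus d, ℂ)) :
    Tendsto (fun N : ℕ => (N : ℂ)⁻¹ * ∑ j ∈ Finset.range N, g (u j)) atTop
      (nhds (∫ x, g x ∂ν)) := by
  have hint : ∀ g : C(UnitAddTorus d, ℂ), Integrable g ν := fun g =>
    .of_bound (C := ‖g‖) g.continuous.aestronglyMeasurable
      (Eventually.of_forall g.norm_coe_le_norm)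
  let A : ℕ → C(UnitAddTorus d, ℂ) → ℂ := fun N g => (N : ℂ)⁻¹ * ∑ j ∈ Finset.range N, g (u j)
  have hA : ∀ N, LipschitzWith 1 (A N) := fun N => .of_dist_le_mul fun g h => by
    rw [dist_eq_norm, dist_eq_norm, NNReal.coe_one, one_mul]
    have hsum : ‖∑ j ∈ Finset.range N, (g - h) (u j)‖ ≤ N * ‖g - h‖ := by
      simpa using! norm_sum_le_of_le (Finset.range N) fun j _ => (g - h).norm_coe_le_norm (u j)
    calc ‖A N g - A N h‖ = (N : ℝ)⁻¹ * ‖∑ j ∈ Finset.range N, (g - h) (u j)‖ := by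
          simp [A, ← mul_sub]
      _ ≤ (N : ℝ)⁻¹ * (N * ‖g - h‖) := by gcongr
      _ ≤ ‖g - h‖ := by
          rw [← mul_assoc]
          exact mul_le_of_le_one_left (norm_nonneg _) (inv_mul_le_one)
  have hI : LipschitzWith 1 fun g : C(UnitAddTorus d, ℂ) => ∫ x, g x ∂ν :=
    .of_dist_le_mul fun g h => by
      rw [dist_eq_norm, dist_eq_norm, NNReal.coe_one, one_mul, ← integral_sub (hint g) (hint h)]
      simpa using norm_integral_le_of_norm_le_const (μ := ν)
        (Eventually.of_forall (g - h).norm_coe_le_norm)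
  have hclosed : IsClosed {g | Tendsto (A · g) atTop (nhds (∫ x, g x ∂ν))} :=
    (LipschitzWith.uniformEquicontinuous A 1 hA).equicontinuous.isClosed_setOfPred_tendsto
      hI.continuous
  have hspan : (Submodule.span ℂ (Set.range (mFourier (d := d))) : Set C(UnitAddTorus d, ℂ)) ⊆
      {g | Tendsto (A · g) atTop (nhds (∫ x, g x ∂ν))} := fun g hg => by
    simp only [Set.mem_ofPred_eq]
    induction hg using Submodule.span_induction with
    | mem g hg =>
      obtain ⟨k, rfl⟩ := hg
      rcases eq_or_ne k 0 with rfl | hk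
      · refine Tendsto.congr' ?_ tendsto_const_nhds
        filter_upwards [eventually_ne_atTop 0] with N hN
        simp [A, mFourier_zero, hN]
      · rw [hν k hk]
        exact hu k hk
    | zero => simp [A]
    | add g h _ _ hg hh =>
      simpa [A, Finset.sum_add_distrib, mul_add, integral_add (hint g) (hint h)] using hg.add hh
    | smul c g _ hg =>
      simpa [A, ← Finset.mul_sum, mul_left_comm, integral_const_mul] using hg.const_mul c
  refine closure_minimal hspan hclosed ?_
  rw [← Submodule.topologicalClosure_coe, span_mFourier_closure_eq_top]
  trivial

omit [Fintype d] in
theorem exists_continuousMap_of_periodic {f : (d → ℝ) → ℝ} (hf : Continuous f)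
    (hper : ∀ (v : d → ℝ) (a : d → ℤ), f (v + fun i => (a i : ℝ)) = f v) :
    ∃ g : C(UnitAddTorus d, ℂ), ∀ y : d → ℝ, g (fun i => (y i : UnitAddCircle)) = f y := by
  have hq : Topology.IsQuotientMap
      (⟨fun (y : d → ℝ) (i : d) => (y i : UnitAddCircle), continuous_mk⟩ :
        C(d → ℝ, UnitAddTorus d)) :=
    (IsOpenQuotientMap.piMap fun _ : d => QuotientAddGroup.isOpenQuotientMap_mk).isQuotientMap
  let F : C(d → ℝ, ℂ) := ⟨fun y => (f y : ℂ), by fun_prop⟩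
  have hF : Function.FactorsThrough F fun (y : d → ℝ) (i : d) => (y i : UnitAddCircle) := by
    intro x y hxy
    have h : ∀ i, ∃ a : ℤ, x i + a = y i := fun i => by
      have hi : ((y i - x i : ℝ) : UnitAddCircle) = 0 := by
        rw [AddCircle.coe_sub, sub_eq_zero]
        exact (congrFun hxy i).symm
      obtain ⟨a, ha⟩ := (AddCircle.coe_eq_zero_iff 1).1 hi
      exact ⟨a, by simp at ha; linarith⟩
    choose a ha using h
    simp only [F, ContinuousMap.coe_mk]
    rw [← hper x a]
    congr 2
    exact funext ha
  exact ⟨hq.lift F hF, fun y => DFunLike.congr_fun (hq.lift_comp F hF) y⟩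

end UnitAddTorus

open UnitAddTorus in
/-- Weyl-type equidistribution: for an injective sequence of integers `nᵢ` and
almost every `y ∈ ℝ^m`, the sequence `nᵢ • y` is equidistributed modulo `ℤ^m`:
for every continuous `ℤ^m`-periodic `f`, the Birkhoff averages converge to the
integral of `f` over the unit cube. -/
theorem ae_equidistribution_of_injective_int_sequence
    (m : ℕ) (hm : 1 ≤ m) (n : ℕ → ℤ) (hn : Function.Injective n) :
    ∀ᵐ y : Fin m → ℝ ∂volume,
      ∀ f : (Fin m → ℝ) → ℝ, Continuous f →
        (∀ (v : Fin m → ℝ) (a : Fin m → ℤ), f (v + fun i => (a i : ℝ)) = f v) →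
        Tendsto
          (fun N : ℕ => (1 / (N : ℝ)) * ∑ i ∈ Finset.range N, f ((n i) • y))
          atTop (nhds (∫ x in Set.Icc (0 : Fin m → ℝ) 1, f x)) := by
  have hae : ∀ᵐ y : Fin m → ℝ, ∀ k : Fin m → ℤ, k ≠ 0 →
      Tendsto (fun N : ℕ => (N : ℂ)⁻¹ * ∑ j ∈ Finset.range N,
        mFourier k (fun i => ((n j • y) i : UnitAddCircle))) atTop (nhds 0) :=
    ae_all_iff.2 fun k => ae_all_iff.2 fun hk => ae_tendsto_average_mFourier_zsmul hn hk
  filter_upwards [hae] with y hy f hf hper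
  obtain ⟨g, hg⟩ := exists_continuousMap_of_periodic hf hper
  let μ := volume.restrict
    {x : Fin m → ℝ | ∀ i, x i ∈ Set.Ioc ((0 : Fin m → ℝ) i) ((0 : Fin m → ℝ) i + 1)}
  have hmk : AEMeasurable (fun (y : Fin m → ℝ) (i : Fin m) => (y i : UnitAddCircle)) μ :=
    continuous_mk.aemeasurable
  have hmap : ∀ h : C(UnitAddTorus (Fin m), ℂ),
      ∫ x, h x ∂(μ.map fun y i => (y i : UnitAddCircle)) = ∫ y, h (fun i => y i) ∂μ := fun h =>
    integral_map hmk h.continuous.aestronglyMeasurable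
  have := Measure.isProbabilityMeasure_map hmk
  have hlim := tendsto_average_of_tendsto_average_mFourier
    (fun k hk => (hmap _).trans (setIntegral_unitCube_mFourier hk 0)) hy g
  have hcube : ∫ y, f y ∂μ = ∫ x in Set.Icc (0 : Fin m → ℝ) 1, f x := by
    simp only [μ]
    rw [setOf_forall_mem_Ioc_eq_pi, volume_pi,
      ← setIntegral_congr_set (Measure.univ_pi_Ioc_ae_eq_Icc (f := (0 : Fin m → ℝ)) (g := 1))]
    simp
  rw [hmap] at hlim
  simp_rw [hg] at hlim
  rw [integral_complex_ofReal, hcube] at hlim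
  have := (Complex.continuous_re.tendsto _).comp hlim
  simpa [Function.comp_def, ← Complex.ofReal_natCast, ← Complex.ofReal_inv, ← Complex.ofReal_sum,
    ← Complex.ofReal_mul] using this
end

section
/- Let m ≥ 1 and let (nᵢ)_{i∈ℕ} be an injective sequence of integers. Then for Lebesgue-almost every y : Fin m → ℝ, the set {nᵢ • y + a | i ∈ ℕ, a : Fin m → ℤ} is dense in ℝ^m. Equivalently, for almost every y, for every x : Fin m → ℝ and every ε > 0, there exist arbitrarily large indices i and integer vectors a ∈ ℤ^m with ‖nᵢ • y + a − x‖ < ε. -/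
open MeasureTheory

open Filter Topology Metric in
/-- A set of `ℝ^m` which is porous at each of its points, along a common sequence of scales and with
a common porosity constant, is Lebesgue-null. -/
theorem volume_eq_zero_of_porous {m : ℕ} {s : Set (Fin m → ℝ)} {r : ℕ → ℝ} {ε : ℝ}
    (hε : 0 < ε) (hr : Tendsto r atTop (𝓝[>] 0))
    (hs : ∀ᶠ i in atTop, ∀ y ∈ s, ∃ z,
      ball z (ε * r i) ⊆ closedBall y (r i) ∧ Disjoint s (ball z (ε * r i))) :
    volume s = 0 := by
  by_contra hpos
  have hne : NeZero (volume.restrict s) := ⟨fun h => hpos (Measure.restrict_eq_zero.1 h)⟩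
  have hmem : ∃ᵐ y ∂volume.restrict s, y ∈ s := by
    rw [frequently_ae_iff]
    refine fun h => hpos ?_
    simpa using (Measure.le_restrict_apply s {a | a ∈ s}).trans_eq h
  obtain ⟨y, hys, hy⟩ :=
    (hmem.and_eventually (Besicovitch.ae_tendsto_measure_inter_div volume s)).exists
  have hlim := (hy.comp hr).add_const (ENNReal.ofReal (ε ^ m))
  have hle : (1 : ENNReal) + ENNReal.ofReal (ε ^ m) ≤ 1 := by
    refine le_of_tendsto hlim ?_
    filter_upwards [hs, hr.eventually self_mem_nhdsWithin] with i hi hri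
    have hri : 0 < r i := hri
    obtain ⟨z, hsub, hdisj⟩ := hi y hys
    have hball : volume (ball z (ε * r i)) =
        ENNReal.ofReal (ε ^ m) * volume (closedBall y (r i)) := by
      rw [Real.volume_pi_ball _ (by positivity), Real.volume_pi_closedBall _ hri.le,
        ← ENNReal.ofReal_mul (by positivity), Fintype.card_fin, ← mul_pow]
      ring_nf
    have hV0 : volume (closedBall y (r i)) ≠ 0 := (measure_closedBall_pos volume y hri).ne'
    have hVt : volume (closedBall y (r i)) ≠ ⊤ := measure_closedBall_lt_top.ne
    have hsum : volume (s ∩ closedBall y (r i)) + volume (ball z (ε * r i)) ≤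
        volume (closedBall y (r i)) := by
      rw [← measure_union (hdisj.mono_left Set.inter_subset_left) measurableSet_ball]
      exact measure_mono (Set.union_subset Set.inter_subset_right hsub)
    calc _ = (volume (s ∩ closedBall y (r i)) + volume (ball z (ε * r i))) /
          volume (closedBall y (r i)) := by
          rw [ENNReal.add_div, hball, ENNReal.mul_div_cancel_right hV0 hVt]
          rfl
      _ ≤ 1 := ENNReal.div_le_of_le_mul (by simpa using hsum)
  have hpow : 0 < ENNReal.ofReal (ε ^ m) := ENNReal.ofReal_pos.2 (by positivity)
  exact absurd hle (not_le.2 (ENNReal.lt_add_right ENNReal.one_ne_top hpow.ne'))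

/-- For every nonzero integer `k`, each point of `ℝ^m` is within `1 / |k|` of a solution `z` of
`k • z ≡ x` modulo `ℤ^m`. -/
theorem exists_norm_sub_le_zsmul_add_intCast_eq {m : ℕ} {k : ℤ} (hk : k ≠ 0) (x y : Fin m → ℝ) :
    ∃ (z : Fin m → ℝ) (a : Fin m → ℤ),
      ‖z - y‖ ≤ 1 / |(k : ℝ)| ∧ k • z + (fun j => (a j : ℝ)) = x := by
  have hk' : (k : ℝ) ≠ 0 := Int.cast_ne_zero.2 hk
  refine ⟨fun j => (x j - round (x j - k * y j)) / k, fun j => round (x j - k * y j), ?_, ?_⟩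
  · refine (pi_norm_le_iff_of_nonneg (by positivity)).2 fun j => ?_
    have h : (x j - round (x j - k * y j)) / k - y j =
        ((x j - k * y j) - round (x j - k * y j)) / k := by
      field_simp
      ring
    rw [Pi.sub_apply, h, Real.norm_eq_abs, abs_div]
    gcongr
    exact (abs_sub_round _).trans (by norm_num)
  · ext j
    rw [Pi.add_apply, Pi.smul_apply, zsmul_eq_mul]
    field_simp
    ring

open Filter Topology Metric in
/-- Along an injective sequence of integers, almost every orbit `n i • y` comes `ε`-close to a given
point modulo `ℤ^m`, at some index beyond any given bound. -/
theorem ae_exists_norm_zsmul_add_intCast_sub_lt {m : ℕ} {n : ℕ → ℤ} (hn : Function.Injective n)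
    (x : Fin m → ℝ) {ε : ℝ} (hε : 0 < ε) (i₀ : ℕ) :
    ∀ᵐ y : Fin m → ℝ ∂volume, ∃ i ≥ i₀, ∃ a : Fin m → ℤ,
      ‖(n i) • y + (fun j => (a j : ℝ)) - x‖ < ε := by
  wlog hε1 : ε ≤ 1 generalizing ε
  · filter_upwards [this one_pos le_rfl] with y ⟨i, hi, a, ha⟩
    exact ⟨i, hi, a, ha.trans (not_le.1 hε1)⟩
  have habs : Tendsto (fun i => |(n i : ℝ)|) atTop atTop := by
    have h := hn.tendsto_cofinite
    rw [Nat.cofinite_eq_atTop] at h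
    exact tendsto_norm_cocompact_atTop.comp (Int.tendsto_coe_cofinite.comp h)
  have hr : Tendsto (fun i => 2 / |(n i : ℝ)|) atTop (𝓝[>] 0) :=
    tendsto_nhdsWithin_iff.2 ⟨habs.const_div_atTop 2, by
      filter_upwards [habs.eventually_gt_atTop 0] with i hi
      exact div_pos two_pos hi⟩
  refine volume_eq_zero_of_porous (half_pos hε) hr ?_
  filter_upwards [habs.eventually_gt_atTop 0, eventually_ge_atTop i₀] with i hi hii y _
  have hk : n i ≠ 0 := by simpa using hi
  obtain ⟨z, a, hzy, hza⟩ := exists_norm_sub_le_zsmul_add_intCast_eq hk x y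
  have hrad : ε / 2 * (2 / |(n i : ℝ)|) = ε / |(n i : ℝ)| := by ring
  rw [hrad]
  refine ⟨z, ball_subset_closedBall.trans (closedBall_subset_closedBall' ?_), ?_⟩
  · calc ε / |(n i : ℝ)| + dist z y ≤ 1 / |(n i : ℝ)| + 1 / |(n i : ℝ)| := by
          rw [dist_eq_norm]
          gcongr
      _ = 2 / |(n i : ℝ)| := by ring
  · refine Set.disjoint_left.2 fun w hw hwz => hw ⟨i, hii, a, ?_⟩
    have hdiff : (n i) • w + (fun j => (a j : ℝ)) - x = (n i : ℝ) • (w - z) := by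
      rw [← hza, add_sub_add_right_eq_sub, ← smul_sub, Int.cast_smul_eq_zsmul]
    rw [mem_ball, dist_eq_norm, lt_div_iff₀ hi] at hwz
    rwa [hdiff, norm_smul, Real.norm_eq_abs, mul_comm]

/-- For an injective sequence of integers `nᵢ` and almost every `y ∈ ℝ^m`, the
set of points `nᵢ • y + a` with `a ∈ ℤ^m` is dense in `ℝ^m`; equivalently one
can approximate any target with arbitrarily large indices `i`. -/
theorem ae_dense_integer_multiples_mod_lattice
    (m : ℕ) (hm : 1 ≤ m) (n : ℕ → ℤ) (hn : Function.Injective n) :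
    ∀ᵐ y : Fin m → ℝ ∂volume,
      Dense {v : Fin m → ℝ | ∃ (i : ℕ) (a : Fin m → ℤ),
        v = (n i) • y + fun j => (a j : ℝ)} ∧
      ∀ x : Fin m → ℝ, ∀ ε : ℝ, 0 < ε → ∀ i₀ : ℕ, ∃ i ≥ i₀, ∃ a : Fin m → ℤ,
        ‖(n i) • y + (fun j => (a j : ℝ)) - x‖ < ε := by
  have hcount : ∀ᵐ y : Fin m → ℝ ∂volume, ∀ p k i₀ : ℕ, ∃ i ≥ i₀, ∃ a : Fin m → ℤ,
      ‖(n i) • y + (fun j => (a j : ℝ)) - TopologicalSpace.denseSeq (Fin m → ℝ) p‖ <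
        1 / ((k : ℝ) + 1) := by
    simp only [ae_all_iff]
    exact fun p k i₀ => ae_exists_norm_zsmul_add_intCast_sub_lt hn _ Nat.one_div_pos_of_nat i₀
  filter_upwards [hcount] with y hy
  have happrox : ∀ x : Fin m → ℝ, ∀ ε : ℝ, 0 < ε → ∀ i₀ : ℕ, ∃ i ≥ i₀, ∃ a : Fin m → ℤ,
      ‖(n i) • y + (fun j => (a j : ℝ)) - x‖ < ε := by
    intro x ε hε i₀
    obtain ⟨p, hp⟩ := (TopologicalSpace.denseRange_denseSeq (Fin m → ℝ)).exists_dist_lt x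
      (half_pos hε)
    obtain ⟨k, hk⟩ := exists_nat_one_div_lt (half_pos hε)
    obtain ⟨i, hi, a, ha⟩ := hy p k i₀
    refine ⟨i, hi, a, ?_⟩
    rw [← dist_eq_norm] at ha ⊢
    rw [dist_comm] at hp
    linarith [dist_triangle ((n i) • y + (fun j => (a j : ℝ)))
      (TopologicalSpace.denseSeq (Fin m → ℝ) p) x]
  refine ⟨Metric.dense_iff.2 fun x ε hε => ?_, happrox⟩
  obtain ⟨i, -, a, ha⟩ := happrox x ε hε 0
  exact ⟨_, mem_ball_iff_norm.2 ha, i, a, rfl⟩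
end
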